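/- One-step correlation formula: for all square-summable f, g : Ẽ → ℝ, ⟨f, Q^Z g⟩_π̃ = Σ_{D⊆J̃} Σ_{n∈ℕ^{J̃}} π̃(D,n)·{Σ_{H⊂D} q^Y(D,H) f(D,n)g(H,n) + Σ_{I⊃D} q^Y(D,I) f(D,n)g(I,n)} + Σ_{D⊆J̃} Σ_{n∈ℕ^{J̃}} π̃(D,n)·(λ/ξ^D_0)·Σ_{j∈J̃₀∖D} Σ_{i∈J̃₀∖D} ξ^D_j r^D_{ji} f(D,n+e_j) g(D,n+e_i) − Σ_{D⊆J̃} Σ_{n∈ℕ^{J̃}} π̃(D,n) f(D,n)g(D,n)·{Σ_{H⊂D} q^Y(D,H) + Σ_{I⊃D} q^Y(D,I) + λ + Σ_{j∈J̃∖D} μ_j(n_j)}, all series converging absolutely. -/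

import Mathlib

open scoped BigOperators

noncomputable section

namespace UnrelNet

/-- State space of the unreliable Jackson network: a set of broken-down nodes
together with a queue-length vector. -/
abbrev Est (J : ℕ) := Finset (Fin J) × (Fin J → ℕ)

/-- The extended node set `J̃₀ ∖ D`: the exterior node `none` together with
the up nodes (complement of `D`). -/
def ext (J : ℕ) (D : Finset (Fin J)) : Finset (Option (Fin J)) :=
  insert none (Dᶜ.image Option.some)

/-- Unit vector `e_j` of `ℕ^J̃`, with `e_0 = 0` (index `none`). -/
def eV {J : ℕ} (o : Option (Fin J)) : Fin J → ℕ := fun i =>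
  match o with
  | none => 0
  | some j => if i = j then 1 else 0

/-- Breakdown/repair generator `Q^Y`. -/
def QY {J : ℕ} (A B : Finset (Fin J) → ℝ) (f : Finset (Fin J) → ℝ)
    (D : Finset (Fin J)) : ℝ :=
  (∑ H ∈ Finset.univ.filter (fun H => H ⊂ D), B D / B H * (f H - f D))
    + ∑ I ∈ Finset.univ.filter (fun I => D ⊂ I), A I / A D * (f I - f D)

/-- Off-diagonal breakdown/repair rates. -/
def qY0 {J : ℕ} (A B : Finset (Fin J) → ℝ) (D E : Finset (Fin J)) : ℝ :=
  if D ⊂ E then A E / A D else if E ⊂ D then B D / B E else 0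

/-- Breakdown/repair rate matrix `q^Y`, including the diagonal. -/
def qY {J : ℕ} (A B : Finset (Fin J) → ℝ) (D E : Finset (Fin J)) : ℝ :=
  if E = D then -∑ F, qY0 A B D F else qY0 A B D E

/-- Breakdown/repair generator written via the rate matrix. -/
def QYm {J : ℕ} (A B : Finset (Fin J) → ℝ) (f : Finset (Fin J) → ℝ)
    (D : Finset (Fin J)) : ℝ :=
  ∑ E, qY A B D E * f E

/-- Normalisation constant `Ĉ`. -/
def Chat {J : ℕ} (A B : Finset (Fin J) → ℝ) : ℝ := ∑ D, A D / B D

/-- Stationary distribution `π̂` of the breakdown/repair process. -/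
def piY {J : ℕ} (A B : Finset (Fin J) → ℝ) (D : Finset (Fin J)) : ℝ :=
  (A D / B D) / Chat A B

/-- `Π_{i=1}^{k} η_j/μ_j(i)`. -/
def prodK {J : ℕ} (η : Fin J → ℝ) (μ : Fin J → ℕ → ℝ) (j : Fin J) (k : ℕ) : ℝ :=
  ∏ i ∈ Finset.range k, η j / μ j (i + 1)

/-- Normalisation constant `C_j`. -/
def Cnorm {J : ℕ} (η : Fin J → ℝ) (μ : Fin J → ℕ → ℝ) (j : Fin J) : ℝ :=
  ∑' k : ℕ, prodK η μ j k

/-- Product-form stationary distribution `π` of the Jackson network. -/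
def piX {J : ℕ} (η : Fin J → ℝ) (μ : Fin J → ℕ → ℝ) (n : Fin J → ℕ) : ℝ :=
  ∏ j, prodK η μ j (n j) / Cnorm η μ j

/-- Product measure `π̃(D,n) = π̂(D)·π(n)`. -/
def piZ {J : ℕ} (η : Fin J → ℝ) (μ : Fin J → ℕ → ℝ) (A B : Finset (Fin J) → ℝ)
    (x : Est J) : ℝ :=
  piY A B x.1 * piX η μ x.2

/-- Generator `Q^Z` of the unreliable Jackson network. -/
def QZ {J : ℕ} (lam : ℝ) (μ : Fin J → ℕ → ℝ)
    (r : Finset (Fin J) → Option (Fin J) → Option (Fin J) → ℝ)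
    (A B : Finset (Fin J) → ℝ) (f : Est J → ℝ) (x : Est J) : ℝ :=
  (∑ j ∈ x.1ᶜ, lam * r x.1 none (some j) * (f (x.1, x.2 + eV (some j)) - f x))
    + (∑ j ∈ x.1ᶜ, μ j (x.2 j) * r x.1 (some j) none * (f (x.1, x.2 - eV (some j)) - f x))
    + (∑ j ∈ x.1ᶜ, ∑ i ∈ x.1ᶜ,
        μ j (x.2 j) * r x.1 (some j) (some i) * (f (x.1, x.2 - eV (some j) + eV (some i)) - f x))
    + (∑ H ∈ Finset.univ.filter (fun H => H ⊂ x.1), B x.1 / B H * (f (H, x.2) - f x))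
    + ∑ I ∈ Finset.univ.filter (fun I => x.1 ⊂ I), A I / A x.1 * (f (I, x.2) - f x)

/-- Transition-rate matrix `q^Z` of the unreliable Jackson network
(between distinct states; the diagonal is set to `0`). -/
def qZ {J : ℕ} (lam : ℝ) (μ : Fin J → ℕ → ℝ)
    (r : Finset (Fin J) → Option (Fin J) → Option (Fin J) → ℝ)
    (A B : Finset (Fin J) → ℝ) (x y : Est J) : ℝ :=
  if x = y then 0
  else
    (if y.1 = x.1 then
        ∑ j ∈ x.1ᶜ,
          ((if y.2 = x.2 + eV (some j) then lam * r x.1 none (some j) else 0)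
            + (if y.2 + eV (some j) = x.2 then μ j (x.2 j) * r x.1 (some j) none else 0)
            + ∑ i ∈ x.1ᶜ,
                if i ≠ j ∧ y.2 + eV (some j) = x.2 + eV (some i) then
                  μ j (x.2 j) * r x.1 (some j) (some i)
                else 0)
      else 0)
    + (if y.2 = x.2 then
        (if y.1 ⊂ x.1 then B x.1 / B y.1 else 0) + (if x.1 ⊂ y.1 then A y.1 / A x.1 else 0)
      else 0)

/-- Extension `η^D` of the traffic solution: `η^D_0 = λ`, `η^D_j = η_j`. -/
def etaE {J : ℕ} (lam : ℝ) (η : Fin J → ℝ) : Option (Fin J) → ℝ := fun o => o.elim lam η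

/-- Normalised routing-equilibrium vector `ξ^D`. -/
def xiV {J : ℕ} (lam : ℝ) (η : Fin J → ℝ) (D : Finset (Fin J))
    (o : Option (Fin J)) : ℝ :=
  etaE lam η o / ∑ k ∈ ext J D, etaE lam η k

/-- Spectral gap of a generator on the network state space w.r.t. a measure `m`. -/
def GapZ {J : ℕ} (m : Est J → ℝ) (Q : (Est J → ℝ) → Est J → ℝ) : ℝ :=
  sInf {v : ℝ | ∃ f : Est J → ℝ,
    Summable (fun x => f x * f x * m x) ∧ (∑' x, f x * m x) = 0 ∧
      (∑' x, f x * f x * m x) = 1 ∧ v = ∑' x, f x * -(Q f x) * m x}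

/-- Spectral gap of a generator on `2^{J̃}` w.r.t. a probability vector `m`. -/
def GapY {J : ℕ} (m : Finset (Fin J) → ℝ)
    (Q : (Finset (Fin J) → ℝ) → Finset (Fin J) → ℝ) : ℝ :=
  sInf {v : ℝ | ∃ f : Finset (Fin J) → ℝ,
    (∑ D, m D * f D) = 0 ∧ (∑ D, m D * f D ^ 2) = 1 ∧
      v = -(∑ D, m D * f D * Q f D)}

/-- Merge a vector indexed by `D` with a vector indexed by `J̃∖D`. -/
def merge {J : ℕ} (D : Finset (Fin J)) (a : {j : Fin J // j ∈ D} → ℕ)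
    (b : {j : Fin J // j ∉ D} → ℕ) : Fin J → ℕ := fun j =>
  if h : j ∈ D then a ⟨j, h⟩ else b ⟨j, h⟩

/-- Marginal product-form density on a sub-collection of nodes. -/
def piSub {J : ℕ} (η : Fin J → ℝ) (μ : Fin J → ℕ → ℝ) (p : Fin J → Prop)
    [DecidablePred p] (a : {j : Fin J // p j} → ℕ) : ℝ :=
  ∏ j : {j : Fin J // p j}, prodK η μ j.1 (a j) / Cnorm η μ j.1

/-- Unit vector on a subtype index set. -/
def eS {J : ℕ} {p : Fin J → Prop} (j : {k : Fin J // p k}) :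
    {k : Fin J // p k} → ℕ := fun i => if i = j then 1 else 0

/-- Generator of the synthetic subnetwork on the up nodes `J̃∖D`. -/
def QXsub {J : ℕ} (lam : ℝ) (μ : Fin J → ℕ → ℝ)
    (r : Finset (Fin J) → Option (Fin J) → Option (Fin J) → ℝ)
    (D : Finset (Fin J)) (h : ({j : Fin J // j ∉ D} → ℕ) → ℝ)
    (m : {j : Fin J // j ∉ D} → ℕ) : ℝ :=
  (∑ j : {j : Fin J // j ∉ D}, lam * r D none (some j.1) * (h (m + eS j) - h m))
    + (∑ j : {j : Fin J // j ∉ D}, μ j.1 (m j) * r D (some j.1) none * (h (m - eS j) - h m))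
    + ∑ j : {j : Fin J // j ∉ D}, ∑ i : {j : Fin J // j ∉ D},
        μ j.1 (m j) * r D (some j.1) (some i.1) * (h (m - eS j + eS i) - h m)

/-- Transition-rate matrix `q^X` of the (reliable) Jackson network. -/
def qX {J : ℕ} (lam : ℝ) (μ : Fin J → ℕ → ℝ)
    (r : Option (Fin J) → Option (Fin J) → ℝ) (n m : Fin J → ℕ) : ℝ :=
  if n = m then 0
  else
    ∑ j : Fin J,
      ((if m = n + eV (some j) then lam * r none (some j) else 0)
        + (if m + eV (some j) = n then μ j (n j) * r (some j) none else 0)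
        + ∑ i : Fin J,
            if i ≠ j ∧ m + eV (some j) = n + eV (some i) then
              μ j (n j) * r (some j) (some i)
            else 0)

/-- One-step Markov operator `K = Id + ε·Q`. -/
def Kop {J : ℕ} (ε : ℝ) (Q : (Est J → ℝ) → Est J → ℝ) :
    (Est J → ℝ) → Est J → ℝ := fun h x => h x + ε * Q h x

section Helpers
variable {J : ℕ}

theorem eV_self (j : Fin J) : eV (some j) j = 1 := by simp [eV]
theorem eV_ne {i j : Fin J} (h : i ≠ j) : eV (some j) i = 0 := by simp [eV, h]
theorem eV_none : eV (none : Option (Fin J)) = 0 := by funext i; simp [eV]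

theorem prodK_nonneg {η : Fin J → ℝ} {μ : Fin J → ℕ → ℝ} (hη : ∀ j, 0 < η j)
    (hμpos : ∀ j k, k ≠ 0 → 0 < μ j k) (j : Fin J) (k : ℕ) : 0 ≤ prodK η μ j k :=
  Finset.prod_nonneg fun i _ => div_nonneg (hη j).le (hμpos j _ (Nat.succ_ne_zero i)).le

theorem piX_nonneg {η : Fin J → ℝ} {μ : Fin J → ℕ → ℝ} (hη : ∀ j, 0 < η j)
    (hμpos : ∀ j k, k ≠ 0 → 0 < μ j k) (n : Fin J → ℕ) : 0 ≤ piX η μ n :=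
  Finset.prod_nonneg fun j _ => div_nonneg (prodK_nonneg hη hμpos j _)
    (tsum_nonneg fun k => prodK_nonneg hη hμpos j k)

theorem piX_shift {η : Fin J → ℝ} {μ : Fin J → ℕ → ℝ}
    (hμpos : ∀ j k, k ≠ 0 → 0 < μ j k) (j : Fin J) (n : Fin J → ℕ) :
    piX η μ (n + eV (some j)) * μ j (n j + 1) = η j * piX η μ n := by
  unfold piX
  rw [← Finset.mul_prod_erase Finset.univ _ (Finset.mem_univ j),
    ← Finset.mul_prod_erase Finset.univ (fun j => prodK η μ j (n j) / Cnorm η μ j)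
      (Finset.mem_univ j)]
  have h1 : ∏ x ∈ Finset.univ.erase j, prodK η μ x ((n + eV (some j)) x) / Cnorm η μ x
      = ∏ x ∈ Finset.univ.erase j, prodK η μ x (n x) / Cnorm η μ x := by
    refine Finset.prod_congr rfl fun x hx => ?_
    rw [Pi.add_apply, eV_ne (Finset.ne_of_mem_erase hx), add_zero]
  have h2 : prodK η μ j (n j + 1) * μ j (n j + 1) = η j * prodK η μ j (n j) := by
    have := (hμpos j (n j + 1) (Nat.succ_ne_zero _)).ne'
    unfold prodK
    rw [Finset.prod_range_succ]
    field_simp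
  rw [h1, Pi.add_apply, eV_self]
  linear_combination (∏ x ∈ Finset.univ.erase j, prodK η μ x (n x) / Cnorm η μ x)
    / Cnorm η μ j * h2

/-- service / arrival intensity -/
def nuE (lam : ℝ) (μ : Fin J → ℕ → ℝ) (o : Option (Fin J)) (m : Fin J → ℕ) : ℝ :=
  match o with
  | none => lam
  | some j => μ j (m j)

theorem piX_shiftE {lam : ℝ} {η : Fin J → ℝ} {μ : Fin J → ℕ → ℝ}
    (hμpos : ∀ j k, k ≠ 0 → 0 < μ j k) (o : Option (Fin J)) (n : Fin J → ℕ) :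
    piX η μ (n + eV o) * nuE lam μ o (n + eV o) = etaE lam η o * piX η μ n := by
  cases o with
  | none => simp [eV_none, nuE, etaE, mul_comm]
  | some j => 
    have := piX_shift (η := η) hμpos j n
    simpa [nuE, etaE, eV_self] using this

theorem nuE_zero {lam : ℝ} {μ : Fin J → ℕ → ℝ} (hμ0 : ∀ j, μ j 0 = 0)
    (o : Option (Fin J)) (m : Fin J → ℕ) (hm : m ∉ Set.range (fun n => n + eV o)) :
    nuE lam μ o m = 0 := by
  cases o with
  | none => exact absurd ⟨m, by simp [eV_none]⟩ hm
  | some j =>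
    by_cases h : m j = 0
    · simp [nuE, h, hμ0]
    · refine absurd ⟨m - eV (some j), tsub_add_cancel_of_le fun i => ?_⟩ hm
      by_cases hi : i = j
      · subst hi; rw [eV_self]; exact Nat.one_le_iff_ne_zero.2 h
      · rw [eV_ne hi]; exact Nat.zero_le _

theorem add_inj' (o : Option (Fin J)) :
    Function.Injective (fun n : Fin J → ℕ => n + eV o) := fun _ _ h => add_right_cancel h

theorem summable_mul_w {α : Type*} {w a b : α → ℝ} (hw : ∀ n, 0 ≤ w n)
    (ha : Summable fun n => a n * a n * w n) (hb : Summable fun n => b n * b n * w n) :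
    Summable fun n => w n * (a n * b n) := by
  refine Summable.of_norm_bounded (ha.add hb) fun n => ?_
  rw [Real.norm_eq_abs, abs_le]
  constructor <;> nlinarith [mul_nonneg (hw n) (sq_nonneg (a n + b n)),
    mul_nonneg (hw n) (sq_nonneg (a n - b n)), mul_nonneg (hw n) (sq_nonneg (a n)),
    mul_nonneg (hw n) (sq_nonneg (b n))]

theorem summable_shift_sq {η : Fin J → ℝ} {μ : Fin J → ℕ → ℝ} (hη : ∀ j, 0 < η j)
    (hμpos : ∀ j k, k ≠ 0 → 0 < μ j k) {M : ℝ} (hM : ∀ j k, μ j k ≤ M)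
    {F : (Fin J → ℕ) → ℝ} (hF : Summable fun n => F n * F n * piX η μ n)
    (o : Option (Fin J)) :
    Summable fun n => F (n + eV o) * F (n + eV o) * piX η μ n := by
  cases o with
  | none => simpa [eV_none] using hF
  | some j =>
    refine Summable.of_nonneg_of_le
      (fun n => mul_nonneg (mul_self_nonneg _) (piX_nonneg hη hμpos n)) (fun n => ?_)
      ((hF.comp_injective (add_inj' (some j))).mul_left (M / η j))
    have h := piX_shift (η := η) hμpos j n
    have h2 : piX η μ n = piX η μ (n + eV (some j)) * μ j (n j + 1) / η j := by
      rw [h]; field_simp [(hη j).ne']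
    have h3 : piX η μ n ≤ M / η j * piX η μ (n + eV (some j)) := by
      rw [h2, div_mul_eq_mul_div, mul_comm M]
      exact div_le_div_of_nonneg_right
        (mul_le_mul_of_nonneg_left (hM _ _) (piX_nonneg hη hμpos _)) (hη j).le
    calc _ ≤ F (n + eV (some j)) * F (n + eV (some j)) * (M / η j * piX η μ (n + eV (some j))) :=
          mul_le_mul_of_nonneg_left h3 (mul_self_nonneg _)
      _ = _ := by simp only [Function.comp]; ring

theorem summable_prod_fin {α β : Type*} [Fintype α] {h : α × β → ℝ}
    (hs : ∀ a, Summable fun b => h (a, b)) : Summable h := by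
  refine Summable.of_abs ?_
  rw [summable_prod_of_nonneg (fun _ => abs_nonneg _)]
  exact ⟨fun a => (hs a).abs, (hasSum_fintype _).summable⟩

theorem sum_ext (D : Finset (Fin J)) (u : Option (Fin J) → ℝ) :
    ∑ o ∈ ext J D, u o = u none + ∑ j ∈ Dᶜ, u (some j) := by
  unfold ext
  rw [Finset.sum_insert (by simp), Finset.sum_image (by simp)]

theorem xi_eq {lam : ℝ} (hlam : 0 < lam) {η : Fin J → ℝ} (hη : ∀ j, 0 < η j)
    (D : Finset (Fin J)) (o : Option (Fin J)) :
    lam / xiV lam η D none * xiV lam η D o = etaE lam η o := by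
  have hS : 0 < ∑ k ∈ ext J D, etaE lam η k := by
    rw [sum_ext]
    exact add_pos_of_pos_of_nonneg hlam (Finset.sum_nonneg fun j _ => (hη j).le)
  have h0 : etaE lam η none = lam := rfl
  unfold xiV
  rw [h0]
  field_simp

theorem qY_down (A B : Finset (Fin J) → ℝ) {D H : Finset (Fin J)} (h : H ⊂ D) :
    qY A B D H = B D / B H := by
  unfold qY qY0
  rw [if_neg h.ne, if_neg (fun h' => h.asymm h'), if_pos h]

theorem qY_up (A B : Finset (Fin J) → ℝ) {D I : Finset (Fin J)} (h : D ⊂ I) :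
    qY A B D I = A I / A D := by
  unfold qY qY0
  rw [if_neg h.ne', if_pos h]

theorem QZ_eq (lam : ℝ) (μ : Fin J → ℕ → ℝ)
    (r : Finset (Fin J) → Option (Fin J) → Option (Fin J) → ℝ)
    (hrsto : ∀ D : Finset (Fin J), ∀ i ∈ ext J D, ∑ j ∈ ext J D, r D i j = 1)
    (A B : Finset (Fin J) → ℝ) (g : Est J → ℝ) (D : Finset (Fin J)) (n : Fin J → ℕ) :
    QZ lam μ r A B g (D, n) =
      ((∑ H ∈ Finset.univ.filter (fun H => H ⊂ D), qY A B D H * g (H, n))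
        + ∑ I ∈ Finset.univ.filter (fun I => D ⊂ I), qY A B D I * g (I, n))
      + (∑ o ∈ ext J D, ∑ o' ∈ ext J D, nuE lam μ o n * r D o o' * g (D, n - eV o + eV o'))
      - g (D, n) * ((∑ H ∈ Finset.univ.filter (fun H => H ⊂ D), qY A B D H)
          + (∑ I ∈ Finset.univ.filter (fun I => D ⊂ I), qY A B D I)
          + lam + ∑ j ∈ Dᶜ, μ j (n j)) := by
  have hd : ∀ u : Finset (Fin J) → ℝ,
      ∑ H ∈ Finset.univ.filter (fun H => H ⊂ D), qY A B D H * u H =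
      ∑ H ∈ Finset.univ.filter (fun H => H ⊂ D), B D / B H * u H := fun u =>
    Finset.sum_congr rfl fun H hH => by rw [qY_down A B (Finset.mem_filter.1 hH).2]
  have hu : ∀ u : Finset (Fin J) → ℝ,
      ∑ H ∈ Finset.univ.filter (fun H => D ⊂ H), qY A B D H * u H =
      ∑ H ∈ Finset.univ.filter (fun H => D ⊂ H), A H / A D * u H := fun u =>
    Finset.sum_congr rfl fun H hH => by rw [qY_up A B (Finset.mem_filter.1 hH).2]
  have hd1 := hd (fun _ => 1)
  have hu1 := hu (fun _ => 1)
  simp only [mul_one] at hd1 hu1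
  rw [hd, hu, hd1, hu1]
  have hk : ∑ o ∈ ext J D, ∑ o' ∈ ext J D,
        nuE lam μ o n * r D o o' * (g (D, n - eV o + eV o') - g (D, n))
      = (∑ o ∈ ext J D, ∑ o' ∈ ext J D, nuE lam μ o n * r D o o' * g (D, n - eV o + eV o'))
        - g (D, n) * (lam + ∑ j ∈ Dᶜ, μ j (n j)) := by
    have : lam + ∑ j ∈ Dᶜ, μ j (n j) = ∑ o ∈ ext J D, nuE lam μ o n := by
      rw [sum_ext]; rfl
    rw [this, Finset.mul_sum, ← Finset.sum_sub_distrib]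
    refine Finset.sum_congr rfl fun o ho => ?_
    simp only [mul_sub, Finset.sum_sub_distrib]
    rw [← Finset.sum_mul, ← Finset.mul_sum, hrsto D o ho]
    ring
  have hk2 : ∑ o ∈ ext J D, ∑ o' ∈ ext J D,
        nuE lam μ o n * r D o o' * (g (D, n - eV o + eV o') - g (D, n))
      = (∑ j ∈ Dᶜ, lam * r D none (some j) * (g (D, n + eV (some j)) - g (D, n)))
    + (∑ j ∈ Dᶜ, μ j (n j) * r D (some j) none * (g (D, n - eV (some j)) - g (D, n)))
    + (∑ j ∈ Dᶜ, ∑ i ∈ Dᶜ, μ j (n j) * r D (some j) (some i) *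
        (g (D, n - eV (some j) + eV (some i)) - g (D, n))) := by
    simp only [sum_ext, eV_none, add_zero, tsub_zero, sub_self, mul_zero, zero_add, nuE,
      Finset.sum_add_distrib]
    ring
  unfold QZ
  simp only
  rw [← hk2, hk]
  simp only [mul_sub, Finset.sum_sub_distrib, ← Finset.sum_mul]
  ring

end Helpers

/-- one-step correlation formula for `⟨f, Q^Z g⟩_π̃`,
all series converging absolutely. -/
theorem one_step_correlation_formula
    (J : ℕ) (hJ : 1 ≤ J)
    (lam : ℝ) (hlam : 0 < lam)
    (μ : Fin J → ℕ → ℝ)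
    (hμ0 : ∀ j, μ j 0 = 0)
    (hμpos : ∀ j k, k ≠ 0 → 0 < μ j k)
    (hμbdd : ∃ M : ℝ, ∀ j k, μ j k ≤ M)
    (r : Finset (Fin J) → Option (Fin J) → Option (Fin J) → ℝ)
    (hrnn : ∀ D : Finset (Fin J), ∀ i ∈ ext J D, ∀ j ∈ ext J D, 0 ≤ r D i j)
    (hrsto : ∀ D : Finset (Fin J), ∀ i ∈ ext J D, ∑ j ∈ ext J D, r D i j = 1)
    (η : Fin J → ℝ) (hη : ∀ j, 0 < η j)
    (htraffic : ∀ D : Finset (Fin J), ∀ j ∈ Dᶜ,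
      η j = lam * r D none (some j) + ∑ i ∈ Dᶜ, η i * r D (some i) (some j))
    (A B : Finset (Fin J) → ℝ)
    (hApos : ∀ D, 0 < A D) (hBpos : ∀ D, 0 < B D)
    (hA0 : A (∅ : Finset (Fin J)) = 1) (hB0 : B (∅ : Finset (Fin J)) = 1)
    (hC : ∀ j, Summable (fun k => prodK η μ j k))
    (f g : Est J → ℝ)
    (hf : Summable (fun x : Est J => f x * f x * piZ η μ A B x))
    (hg : Summable (fun x : Est J => g x * g x * piZ η μ A B x)) :
    Summable (fun x : Est J => f x * QZ lam μ r A B g x * piZ η μ A B x)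
      ∧ (∀ D : Finset (Fin J),
          Summable (fun n : Fin J → ℕ =>
            piZ η μ A B (D, n) *
              ((∑ H ∈ Finset.univ.filter (fun H => H ⊂ D), qY A B D H * f (D, n) * g (H, n))
                + ∑ I ∈ Finset.univ.filter (fun I => D ⊂ I), qY A B D I * f (D, n) * g (I, n)))
          ∧ Summable (fun n : Fin J → ℕ =>
              piZ η μ A B (D, n) * (lam / xiV lam η D none) *
                ∑ j ∈ ext J D, ∑ i ∈ ext J D,
                  xiV lam η D j * r D j i * f (D, n + eV j) * g (D, n + eV i))
          ∧ Summable (fun n : Fin J → ℕ =>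
              piZ η μ A B (D, n) * f (D, n) * g (D, n) *
                ((∑ H ∈ Finset.univ.filter (fun H => H ⊂ D), qY A B D H)
                  + (∑ I ∈ Finset.univ.filter (fun I => D ⊂ I), qY A B D I)
                  + lam + ∑ j ∈ Dᶜ, μ j (n j))))
      ∧ (∑' x : Est J, f x * QZ lam μ r A B g x * piZ η μ A B x)
          = (∑ D : Finset (Fin J), ∑' n : Fin J → ℕ,
              piZ η μ A B (D, n) *
                ((∑ H ∈ Finset.univ.filter (fun H => H ⊂ D), qY A B D H * f (D, n) * g (H, n))
                  + ∑ I ∈ Finset.univ.filter (fun I => D ⊂ I), qY A B D I * f (D, n) * g (I, n)))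
            + (∑ D : Finset (Fin J), ∑' n : Fin J → ℕ,
                piZ η μ A B (D, n) * (lam / xiV lam η D none) *
                  ∑ j ∈ ext J D, ∑ i ∈ ext J D,
                    xiV lam η D j * r D j i * f (D, n + eV j) * g (D, n + eV i))
            - ∑ D : Finset (Fin J), ∑' n : Fin J → ℕ,
                piZ η μ A B (D, n) * f (D, n) * g (D, n) *
                  ((∑ H ∈ Finset.univ.filter (fun H => H ⊂ D), qY A B D H)
                    + (∑ I ∈ Finset.univ.filter (fun I => D ⊂ I), qY A B D I)
                    + lam + ∑ j ∈ Dᶜ, μ j (n j)) := by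
  obtain ⟨M, hM⟩ := hμbdd
  have hw := piX_nonneg (η := η) (μ := μ) hη hμpos
  have hChat : 0 < Chat A B :=
    Finset.sum_pos (fun D _ => div_pos (hApos D) (hBpos D)) Finset.univ_nonempty
  have hpY : ∀ D, 0 < piY A B D := fun D => div_pos (div_pos (hApos D) (hBpos D)) hChat
  have hsec : ∀ {h : Est J → ℝ}, Summable (fun x : Est J => h x * h x * piZ η μ A B x) →
      ∀ D, Summable fun n => h (D, n) * h (D, n) * piX η μ n := by
    intro h hh D
    have h1 := (hh.comp_injective (Prod.mk_right_injective D)).mul_left (piY A B D)⁻¹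
    refine h1.congr fun n => ?_
    have := (hpY D).ne'
    simp only [Function.comp, piZ]
    field_simp
  have hfs := hsec hf
  have hgs := hsec hg
  have hfg : ∀ D H, Summable fun n => piX η μ n * (f (D, n) * g (H, n)) := fun D H =>
    summable_mul_w hw (hfs D) (hgs H)
  -- first family
  have S1 : ∀ D : Finset (Fin J), Summable (fun n : Fin J → ℕ =>
      piZ η μ A B (D, n) *
        ((∑ H ∈ Finset.univ.filter (fun H => H ⊂ D), qY A B D H * f (D, n) * g (H, n))
          + ∑ I ∈ Finset.univ.filter (fun I => D ⊂ I), qY A B D I * f (D, n) * g (I, n))) := by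
    intro D
    have h1 := (summable_sum (s := Finset.univ.filter (fun H => H ⊂ D))
      fun H _ => (hfg D H).mul_left (piY A B D * qY A B D H)).add
      (summable_sum (s := Finset.univ.filter (fun I => D ⊂ I))
      fun H _ => (hfg D H).mul_left (piY A B D * qY A B D H))
    refine h1.congr fun n => ?_
    simp only [piZ, mul_add, Finset.mul_sum]
    congr 1 <;> exact Finset.sum_congr rfl fun _ _ => by ring
  -- shifted terms
  have T0 : ∀ D o o', Summable fun n : Fin J → ℕ =>
      piZ η μ A B (D, n) * etaE lam η o * r D o o' * f (D, n + eV o) * g (D, n + eV o') := by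
    intro D o o'
    have h1 := (summable_mul_w hw (summable_shift_sq hη hμpos hM (hfs D) o)
      (summable_shift_sq hη hμpos hM (hgs D) o')).mul_left
        (piY A B D * etaE lam η o * r D o o')
    refine h1.congr fun n => ?_
    simp only [piZ]
    ring
  have T2eq : ∀ D n, piZ η μ A B (D, n) * (lam / xiV lam η D none) *
        ∑ j ∈ ext J D, ∑ i ∈ ext J D,
          xiV lam η D j * r D j i * f (D, n + eV j) * g (D, n + eV i)
      = ∑ o ∈ ext J D, ∑ o' ∈ ext J D, piZ η μ A B (D, n) * etaE lam η o * r D o o'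
          * f (D, n + eV o) * g (D, n + eV o') := by
    intro D n
    simp only [Finset.mul_sum]
    refine Finset.sum_congr rfl fun o _ => Finset.sum_congr rfl fun o' _ => ?_
    rw [← xi_eq hlam hη D o]
    ring
  have S2 : ∀ D : Finset (Fin J), Summable (fun n : Fin J → ℕ =>
      piZ η μ A B (D, n) * (lam / xiV lam η D none) *
        ∑ j ∈ ext J D, ∑ i ∈ ext J D,
          xiV lam η D j * r D j i * f (D, n + eV j) * g (D, n + eV i)) := by
    intro D
    simp only [T2eq]
    exact summable_sum fun o _ => summable_sum fun o' _ => T0 D o o'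
  -- third family
  have S3 : ∀ D : Finset (Fin J), Summable (fun n : Fin J → ℕ =>
      piZ η μ A B (D, n) * f (D, n) * g (D, n) *
        ((∑ H ∈ Finset.univ.filter (fun H => H ⊂ D), qY A B D H)
          + (∑ I ∈ Finset.univ.filter (fun I => D ⊂ I), qY A B D I)
          + lam + ∑ j ∈ Dᶜ, μ j (n j))) := by
    intro D
    have hj : ∀ j, Summable fun n : Fin J → ℕ =>
        piX η μ n * (f (D, n) * g (D, n)) * μ j (n j) := by
      intro j
      refine Summable.of_norm_bounded ((hfg D D).abs.mul_right M) fun n => ?_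
      rw [Real.norm_eq_abs, abs_mul]
      refine mul_le_mul_of_nonneg_left ?_ (abs_nonneg _)
      have h0 : 0 ≤ μ j (n j) := by
        by_cases h : n j = 0
        · rw [h, hμ0]
        · exact (hμpos j _ h).le
      rw [abs_of_nonneg h0]
      exact hM _ _
    have h1 := (((hfg D D).mul_right ((∑ H ∈ Finset.univ.filter (fun H => H ⊂ D), qY A B D H)
          + (∑ I ∈ Finset.univ.filter (fun I => D ⊂ I), qY A B D I) + lam)).add
      (summable_sum (s := Dᶜ) fun j _ => hj j)).mul_left (piY A B D)
    refine h1.congr fun n => ?_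
    rw [← Finset.mul_sum]
    simp only [piZ]
    ring
  -- unshifted terms
  have HP : ∀ D o o', HasSum (fun m : Fin J → ℕ =>
      piZ η μ A B (D, m) * nuE lam μ o m * r D o o' * f (D, m) * g (D, m - eV o + eV o'))
      (∑' n : Fin J → ℕ, piZ η μ A B (D, n) * etaE lam η o * r D o o'
        * f (D, n + eV o) * g (D, n + eV o')) := by
    intro D o o'
    rw [← (add_inj' o).hasSum_iff]
    · convert (T0 D o o').hasSum using 1
      funext n
      have h := piX_shiftE (lam := lam) (η := η) hμpos o n
      simp only [Function.comp, piZ, add_tsub_cancel_right]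
      linear_combination piY A B D * r D o o' * f (D, n + eV o) * g (D, n + eV o') * h
    · intro m hm
      rw [nuE_zero hμ0 o m hm]
      ring
  have HP2 : ∀ D, HasSum (fun m : Fin J → ℕ => ∑ o ∈ ext J D, ∑ o' ∈ ext J D,
      piZ η μ A B (D, m) * nuE lam μ o m * r D o o' * f (D, m) * g (D, m - eV o + eV o'))
      (∑' n : Fin J → ℕ, piZ η μ A B (D, n) * (lam / xiV lam η D none) *
        ∑ j ∈ ext J D, ∑ i ∈ ext J D,
          xiV lam η D j * r D j i * f (D, n + eV j) * g (D, n + eV i)) := by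
    intro D
    have h2 : HasSum (fun n : Fin J → ℕ => ∑ o ∈ ext J D, ∑ o' ∈ ext J D,
        piZ η μ A B (D, n) * etaE lam η o * r D o o' * f (D, n + eV o) * g (D, n + eV o')) _ :=
      hasSum_sum fun o _ => hasSum_sum fun o' _ => (T0 D o o').hasSum
    simp only [T2eq]
    rw [h2.tsum_eq]
    exact hasSum_sum fun o _ => hasSum_sum fun o' _ => HP D o o'
  have HD : ∀ D, HasSum (fun n : Fin J → ℕ =>
      f (D, n) * QZ lam μ r A B g (D, n) * piZ η μ A B (D, n)) _ := fun D => by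
    have h := (((S1 D).hasSum.add (HP2 D)).sub (S3 D).hasSum)
    refine Eq.mpr (congrArg (fun u => HasSum u _) (funext fun n => ?_)) h
    rw [QZ_eq lam μ r hrsto]
    have e1 : ∀ s : Finset (Finset (Fin J)), ∑ H ∈ s, qY A B D H * f (D, n) * g (H, n)
        = f (D, n) * ∑ H ∈ s, qY A B D H * g (H, n) := fun s => by
      rw [Finset.mul_sum]; exact Finset.sum_congr rfl fun _ _ => by ring
    have e2 : ∑ o ∈ ext J D, ∑ o' ∈ ext J D, piZ η μ A B (D, n) * nuE lam μ o n * r D o o'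
          * f (D, n) * g (D, n - eV o + eV o')
        = piZ η μ A B (D, n) * f (D, n) * ∑ o ∈ ext J D, ∑ o' ∈ ext J D,
          nuE lam μ o n * r D o o' * g (D, n - eV o + eV o') := by
      simp only [Finset.mul_sum]
      exact Finset.sum_congr rfl fun _ _ => Finset.sum_congr rfl fun _ _ => by ring
    rw [e1, e1, e2]
    ring
  have HS : Summable (fun x : Est J => f x * QZ lam μ r A B g x * piZ η μ A B x) :=
    summable_prod_fin fun D => (HD D).summable
  refine ⟨HS, fun D => ⟨S1 D, S2 D, S3 D⟩, ?_⟩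
  rw [HS.tsum_prod, tsum_fintype, ← Finset.sum_add_distrib, ← Finset.sum_sub_distrib]
  exact Finset.sum_congr rfl fun D _ => (HD D).tsum_eq

end UnrelNet
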